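/- arXiv:2506.17065 — 3 statements merged into one kernel-verified Lean document; each statement's English description precedes it below -/
import Mathlib

section
/- Let K ≥ 1 and let ω, ω̃ : {1,…,K} → ℝ² with ω^r = (ω^r_1, ω^r_0) and ω̃^r = (ω̃^r_1, ω̃^r_0). Suppose there exist two distinct real numbers s ≠ t such that for every u ∈ {s, t} and every r ∈ {1,…,K}, π_u(ω)^r = π_u(ω̃)^r. Then there exist Δ_1, Δ_0 ∈ ℝ such that for every r, ω^r_1 = ω̃^r_1 + Δ_1 and ω^r_0 = ω̃^r_0 + Δ_0; i.e., ω and ω̃ differ by a common translation of ℝ². -/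
open Finset

/-- Time-varying softmax weights: for parameters `ω r = (ω^r_1, ω^r_0) ∈ ℝ²`
and time `t ∈ ℝ`,
`π_t(ω)^r = exp(ω^r_1 · t + ω^r_0) / ∑ j, exp(ω^j_1 · t + ω^j_0)`. -/
noncomputable def timeVaryingWeight {K : ℕ} (ω : Fin K → ℝ × ℝ) (t : ℝ)
    (r : Fin K) : ℝ :=
  Real.exp ((ω r).1 * t + (ω r).2) / ∑ j, Real.exp ((ω j).1 * t + (ω j).2)

/-- The logarithm of a softmax weight is its score minus the log-partition function. -/
theorem log_timeVaryingWeight {K : ℕ} (ω : Fin K → ℝ × ℝ) (t : ℝ) (r : Fin K) :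
    Real.log (timeVaryingWeight ω t r) =
      (ω r).1 * t + (ω r).2 - Real.log (∑ j, Real.exp ((ω j).1 * t + (ω j).2)) := by
  have hpos : 0 < ∑ j, Real.exp ((ω j).1 * t + (ω j).2) :=
    Finset.sum_pos (fun j _ => Real.exp_pos _) ⟨r, Finset.mem_univ r⟩
  rw [timeVaryingWeight, Real.log_div (Real.exp_ne_zero _) hpos.ne', Real.log_exp]

/-- Parameters with equal softmax weights at time `t` have scores differing by a constant. -/
theorem exists_score_eq_add_of_timeVaryingWeight_eq {K : ℕ} {ω ω' : Fin K → ℝ × ℝ} {t : ℝ}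
    (h : ∀ r, timeVaryingWeight ω t r = timeVaryingWeight ω' t r) :
    ∃ c : ℝ, ∀ r, (ω r).1 * t + (ω r).2 = (ω' r).1 * t + (ω' r).2 + c := by
  refine ⟨Real.log (∑ j, Real.exp ((ω j).1 * t + (ω j).2)) -
    Real.log (∑ j, Real.exp ((ω' j).1 * t + (ω' j).2)), fun r => ?_⟩
  have hlog := congrArg Real.log (h r)
  rw [log_timeVaryingWeight, log_timeVaryingWeight] at hlog
  linarith

/-- Translation identifiability of time-varying softmax weights: if the softmax
weights of `ω` and `ω'` agree at two distinct time points `s ≠ t`, then `ω` and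
`ω'` differ by a common translation `(Δ₁, Δ₀)` of `ℝ²`. -/
theorem softmax_weights_translation_identifiable {K : ℕ} (hK : 1 ≤ K)
    (ω ω' : Fin K → ℝ × ℝ) (s t : ℝ) (hst : s ≠ t)
    (h : ∀ u ∈ ({s, t} : Set ℝ), ∀ r : Fin K,
      timeVaryingWeight ω u r = timeVaryingWeight ω' u r) :
    ∃ Δ₁ Δ₀ : ℝ, ∀ r : Fin K,
      (ω r).1 = (ω' r).1 + Δ₁ ∧ (ω r).2 = (ω' r).2 + Δ₀ := by
  obtain ⟨a, ha⟩ := exists_score_eq_add_of_timeVaryingWeight_eq (h s (by simp))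
  obtain ⟨b, hb⟩ := exists_score_eq_add_of_timeVaryingWeight_eq (h t (by simp))
  have hne : s - t ≠ 0 := sub_ne_zero.mpr hst
  refine ⟨(a - b) / (s - t), a - (a - b) / (s - t) * s, fun r => ?_⟩
  have hslope : (ω r).1 = (ω' r).1 + (a - b) / (s - t) := by
    field_simp
    linear_combination ha r - hb r
  exact ⟨hslope, by linear_combination ha r - s * hslope⟩
end

section
/- Let X and ι be types and let F : ι → (X → ℝ) be a family of functions that is linearly independent over ℝ. Let K, K̃ ∈ ℕ, let φ : Fin K → ι and ψ : Fin K̃ → ι be injective, let ω : Fin K → ℝ² and ω̃ : Fin K̃ → ℝ², and let T ⊆ ℝ be nonempty. Suppose that for every t ∈ T and every x ∈ X, ∑_{r=1}^{K} π_t(ω)^r · F(φ(r))(x) = ∑_{r=1}^{K̃} π_t(ω̃)^r · F(ψ(r))(x). Then K = K̃ and there exists a bijection σ : Fin K → Fin K̃, not depending on t, such that ψ(σ(r)) = φ(r) for every r and π_t(ω̃)^{σ(r)} = π_t(ω)^r for every t ∈ T and every r. -/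
open Finset

/-- Two linear combinations of a linearly independent family along injective
selections of indices that agree have the same coefficient at each index of the
first selection carrying a nonzero coefficient. -/
theorem LinearIndependent.exists_eq_of_sum_smul_eq {R M ι α β : Type*} [Semiring R]
    [AddCommMonoid M] [Module R M] [Fintype α] [Fintype β] {v : ι → M}
    (hv : LinearIndependent R v) {φ : α → ι} {ψ : β → ι}
    (hφ : Function.Injective φ) (hψ : Function.Injective ψ) {a : α → R} {b : β → R}
    (h : ∑ i, a i • v (φ i) = ∑ j, b j • v (ψ j)) {i : α} (hi : a i ≠ 0) :
    ∃ j, ψ j = φ i ∧ b j = a i := by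
  have key : (Finsupp.equivFunOnFinite.symm a).mapDomain φ
      = (Finsupp.equivFunOnFinite.symm b).mapDomain ψ := by
    apply hv
    rw [Finsupp.linearCombination_mapDomain, Finsupp.linearCombination_mapDomain]
    simpa [Finsupp.linearCombination_apply, Finsupp.sum_fintype] using h
  have hcoeff := DFunLike.congr_fun key (φ i)
  rw [Finsupp.mapDomain_apply hφ] at hcoeff
  by_cases hr : φ i ∈ Set.range ψ
  · obtain ⟨j, hj⟩ := hr
    refine ⟨j, hj, ?_⟩
    rw [← hj, Finsupp.mapDomain_apply hψ] at hcoeff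
    exact hcoeff.symm
  · rw [Finsupp.mapDomain_of_notMem_range _ _ hr] at hcoeff
    exact absurd hcoeff hi

theorem timeVaryingWeight_pos {K : ℕ} (ω : Fin K → ℝ × ℝ) (t : ℝ) (r : Fin K) :
    0 < timeVaryingWeight ω t r :=
  div_pos (Real.exp_pos _) (Finset.sum_pos (fun _ _ => Real.exp_pos _) ⟨r, Finset.mem_univ r⟩)

/-- Component-matching step in the identifiability of mixtures of identifiable
temporal causal models: if the family `F : ι → (X → ℝ)` is linearly independent
over `ℝ`, `φ` and `ψ` are injective selections of components, and the two
softmax-weighted mixtures agree for every time `t` in a nonempty set `T ⊆ ℝ`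
and every `x`, then the numbers of components agree and there is a bijection
`σ`, not depending on `t`, matching the components and the weights. -/
theorem mixture_component_matching {X ι : Type*} (F : ι → X → ℝ)
    (hF : LinearIndependent ℝ F)
    {K K' : ℕ} (φ : Fin K → ι) (ψ : Fin K' → ι)
    (hφ : Function.Injective φ) (hψ : Function.Injective ψ)
    (ω : Fin K → ℝ × ℝ) (ω' : Fin K' → ℝ × ℝ)
    (T : Set ℝ) (hT : T.Nonempty)
    (heq : ∀ t ∈ T, ∀ x : X,
      ∑ r, timeVaryingWeight ω t r * F (φ r) x
        = ∑ r, timeVaryingWeight ω' t r * F (ψ r) x) :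
    K = K' ∧ ∃ σ : Fin K ≃ Fin K', (∀ r, ψ (σ r) = φ r) ∧
      ∀ t ∈ T, ∀ r, timeVaryingWeight ω' t (σ r) = timeVaryingWeight ω t r := by
  have hsum : ∀ t ∈ T, ∑ r, timeVaryingWeight ω t r • F (φ r)
      = ∑ r, timeVaryingWeight ω' t r • F (ψ r) := by
    intro t ht
    funext x
    simpa [Finset.sum_apply] using heq t ht x
  have hmatch : ∀ t ∈ T, ∀ r, ∃ s, ψ s = φ r ∧
      timeVaryingWeight ω' t s = timeVaryingWeight ω t r := fun t ht r =>
    hF.exists_eq_of_sum_smul_eq hφ hψ (hsum t ht) (timeVaryingWeight_pos ω t r).ne'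
  obtain ⟨t₀, ht₀⟩ := hT
  choose f hf _ using hmatch t₀ ht₀
  have hbij : Function.Bijective f := by
    refine ⟨fun r r' h => hφ (by rw [← hf r, ← hf r', h]), fun s => ?_⟩
    obtain ⟨r, hr, -⟩ := hF.exists_eq_of_sum_smul_eq hψ hφ (hsum t₀ ht₀).symm
      (timeVaryingWeight_pos ω' t₀ s).ne'
    exact ⟨r, hψ ((hf r).trans hr)⟩
  let σ := Equiv.ofBijective f hbij
  refine ⟨by simpa using Fintype.card_congr σ, σ, hf, fun t ht r => ?_⟩
  obtain ⟨s, hs, hw⟩ := hmatch t ht r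
  have hσ : σ r = s := hψ ((hf r).trans hs.symm)
  rw [hσ, hw]
end

section
/- Let f¹, g¹, f², g² : ℝ → ℝ be twice differentiable with g¹ > 0 and g² > 0, and let p₁, p₂, q₁, q₂ : ℝ → ℝ be strictly positive functions whose logarithms are twice differentiable; write ν₁ = log p₁ and ν₂ = log q₂. Suppose the same strictly positive joint density on ℝ² admits both a forward and a backward heteroscedastic factorization, i.e., for all (x₁, x₂) ∈ ℝ², p₂(x₂) · q₁((x₁ − f¹(x₂))/g¹(x₂)) / g¹(x₂) = p₁(x₁) · q₂((x₂ − f²(x₁))/g²(x₁)) / g²(x₁). Define N(x₁, x₂) = ν₂((x₂ − f²(x₁))/g²(x₁)) − log g²(x₁) and G(x₂, x₁) = g¹(x₂)·(f¹)'(x₂) + (g¹)'(x₂)·(x₁ − f¹(x₂)). Then for every (x₁, x₂) with G(x₂, x₁) ≠ 0, the following partial differential equation holds: 0 = ν₁''(x₁) + ((g¹)'(x₂)/G(x₂,x₁))·ν₁'(x₁) + ∂²N/∂x₁²(x₁,x₂) + (g¹(x₂)/G(x₂,x₁))·∂²N/∂x₁∂x₂(x₁,x₂) + ((g¹)'(x₂)/G(x₂,x₁))·∂N/∂x₁(x₁,x₂).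 -/
/-- A `C²` function has a derivative at every point, and so does its derivative. -/
lemma hasDerivAt_and_hasDerivAt_deriv_of_contDiff_two {f : ℝ → ℝ} (hf : ContDiff ℝ 2 f) :
    (∀ x, HasDerivAt f (deriv f x) x) ∧
      ∀ x, HasDerivAt (deriv f) (deriv (deriv f) x) x := by
  have hf' : ContDiff ℝ (1 + 1) f := by simpa [one_add_one_eq_two] using hf
  exact ⟨fun x => (hf.differentiable (by norm_num) x).hasDerivAt,
    fun x => ((contDiff_succ_iff_deriv.1 hf').2.2.differentiable (by norm_num) x).hasDerivAt⟩

/-- Taking logarithms in the equality of the two heteroscedastic factorizations expresses the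
backward log-conditional through the forward model. -/
lemma log_backward_eq_of_density_eq {a b c d r s : ℝ} (ha : 0 < a) (hb : 0 < b) (hc : 0 < c)
    (hd : 0 < d) (hr : 0 < r) (hs : 0 < s) (h : a * b / r = c * d / s) :
    Real.log d - Real.log s
      = Real.log a - Real.log r + Real.log b - Real.log c := by
  have h' := congrArg Real.log h
  rw [Real.log_div (mul_pos ha hb).ne' hr.ne', Real.log_div (mul_pos hc hd).ne' hs.ne',
    Real.log_mul ha.ne' hb.ne', Real.log_mul hc.ne' hd.ne'] at h'
  linarith

/-- If a strictly positive joint density on `ℝ²` admits both a forward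
heteroscedastic factorization
`p(x₁,x₂) = p₂(x₂) · q₁((x₁ − f¹(x₂))/g¹(x₂)) / g¹(x₂)`
(encoding `x¹ = f¹(x²) + g¹(x²)·ε¹`) and a backward one
`p(x₁,x₂) = p₁(x₁) · q₂((x₂ − f²(x₁))/g²(x₁)) / g²(x₁)`
(encoding `x² = f²(x¹) + g²(x¹)·ε²`), then, writing `ν₁ = log p₁`,
`ν₂ = log q₂`, `N(x₁,x₂) = ν₂((x₂ − f²(x₁))/g²(x₁)) − log g²(x₁)` and
`G(x₂,x₁) = g¹(x₂)·(f¹)'(x₂) + (g¹)'(x₂)·(x₁ − f¹(x₂))`, the partial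
differential equation
`0 = ν₁''(x₁) + ((g¹)'(x₂)/G)·ν₁'(x₁) + ∂²N/∂x₁² + (g¹(x₂)/G)·∂²N/∂x₁∂x₂
   + ((g¹)'(x₂)/G)·∂N/∂x₁`
holds at every point where `G(x₂,x₁) ≠ 0`. -/
theorem backward_heteroscedastic_model_pde
    (f1 g1 f2 g2 : ℝ → ℝ)
    (hf1 : ContDiff ℝ 2 f1) (hg1 : ContDiff ℝ 2 g1)
    (hf2 : ContDiff ℝ 2 f2) (hg2 : ContDiff ℝ 2 g2)
    (hg1_pos : ∀ x, 0 < g1 x) (hg2_pos : ∀ x, 0 < g2 x)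
    (p1 p2 q1 q2 : ℝ → ℝ)
    (hp1_pos : ∀ x, 0 < p1 x) (hp2_pos : ∀ x, 0 < p2 x)
    (hq1_pos : ∀ x, 0 < q1 x) (hq2_pos : ∀ x, 0 < q2 x)
    (hlogp1 : ContDiff ℝ 2 (fun x => Real.log (p1 x)))
    (hlogp2 : ContDiff ℝ 2 (fun x => Real.log (p2 x)))
    (hlogq1 : ContDiff ℝ 2 (fun x => Real.log (q1 x)))
    (hlogq2 : ContDiff ℝ 2 (fun x => Real.log (q2 x)))
    (hdensity : ∀ x1 x2 : ℝ,
      p2 x2 * q1 ((x1 - f1 x2) / g1 x2) / g1 x2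
        = p1 x1 * q2 ((x2 - f2 x1) / g2 x1) / g2 x1) :
    ∀ x1 x2 : ℝ,
      g1 x2 * deriv f1 x2 + deriv g1 x2 * (x1 - f1 x2) ≠ 0 →
      (0 : ℝ) =
        deriv (deriv (fun y => Real.log (p1 y))) x1
        + (deriv g1 x2 / (g1 x2 * deriv f1 x2 + deriv g1 x2 * (x1 - f1 x2)))
            * deriv (fun y => Real.log (p1 y)) x1
        + deriv (deriv (fun y1 =>
            Real.log (q2 ((x2 - f2 y1) / g2 y1)) - Real.log (g2 y1))) x1
        + (g1 x2 / (g1 x2 * deriv f1 x2 + deriv g1 x2 * (x1 - f1 x2)))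
            * deriv (fun y2 => deriv (fun y1 =>
              Real.log (q2 ((y2 - f2 y1) / g2 y1)) - Real.log (g2 y1)) x1) x2
        + (deriv g1 x2 / (g1 x2 * deriv f1 x2 + deriv g1 x2 * (x1 - f1 x2)))
            * deriv (fun y1 =>
              Real.log (q2 ((x2 - f2 y1) / g2 y1)) - Real.log (g2 y1)) x1 := by
  intro x1 x2 hG
  have hN : ∀ y1 y2, Real.log (q2 ((y2 - f2 y1) / g2 y1)) - Real.log (g2 y1)
      = Real.log (p2 y2) - Real.log (g1 y2) + Real.log (q1 ((y1 - f1 y2) / g1 y2))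
        - Real.log (p1 y1) := fun y1 y2 =>
    log_backward_eq_of_density_eq (hp2_pos _) (hq1_pos _) (hp1_pos _) (hq2_pos _) (hg1_pos _)
      (hg2_pos _) (hdensity y1 y2)
  simp only [hN]
  obtain ⟨hL, hL'⟩ := hasDerivAt_and_hasDerivAt_deriv_of_contDiff_two hlogq1
  obtain ⟨hν, hν'⟩ := hasDerivAt_and_hasDerivAt_deriv_of_contDiff_two hlogp1
  have hf := (hasDerivAt_and_hasDerivAt_deriv_of_contDiff_two hf1).1 x2
  have hg := (hasDerivAt_and_hasDerivAt_deriv_of_contDiff_two hg1).1 x2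
  set L := fun x => Real.log (q1 x)
  set ν := fun x => Real.log (p1 x)
  have hg0 := (hg1_pos x2).ne'
  have hu : ∀ y1 y2, HasDerivAt (fun y => (y - f1 y2) / g1 y2) (1 / g1 y2) y1 := fun y1 y2 =>
    ((hasDerivAt_id y1).sub_const _).div_const _
  have hN1 : ∀ y1 y2, deriv (fun y1 => Real.log (p2 y2) - Real.log (g1 y2)
      + Real.log (q1 ((y1 - f1 y2) / g1 y2)) - Real.log (p1 y1)) y1
      = deriv L ((y1 - f1 y2) / g1 y2) * (1 / g1 y2) - deriv ν y1 := fun y1 y2 =>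
    ((((hL _).comp y1 (hu y1 y2)).const_add _).sub (hν y1)).deriv
  have hN11 : deriv (fun y1 => deriv L ((y1 - f1 x2) / g1 x2) * (1 / g1 x2) - deriv ν y1) x1
      = deriv (deriv L) ((x1 - f1 x2) / g1 x2) * (1 / g1 x2) * (1 / g1 x2)
        - deriv (deriv ν) x1 :=
    ((((hL' _).comp x1 (hu x1 x2)).mul_const _).sub (hν' x1)).deriv
  have hu2 := (hf.const_sub x1).div hg hg0
  have hN12 : deriv (fun y2 => deriv L ((x1 - f1 y2) / g1 y2) * (1 / g1 y2) - deriv ν x1) x2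
      = _ :=
    ((((hL' _).comp x2 hu2).mul ((hasDerivAt_const x2 (1 : ℝ)).div hg hg0)).sub_const
      (deriv ν x1)).deriv
  rw [funext fun y1 => hN1 y1 x2, funext fun y2 => hN1 x1 y2, hN11, hN12]
  simp only [Function.comp_apply, Pi.div_apply]
  field_simp
  ring
end
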